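/- Let 𝔭 be a prime partial ideal of M₃(ℂ), and define c : M₃(ℂ) → ℤ by c(X) = 0 if X ∈ 𝔭 and c(X) = 1 if X ∉ 𝔭. Then for every pair of projections P, Q ∈ M₃(ℂ) with PQ = QP, one has c(P+Q) = c(P) + c(Q) and c(PQ) = c(P)·c(Q). -/

import Mathlib

open Matrix

/-- A subset `𝔭` of a ring `R` is a *prime partial ideal* if for every commutative
subring `C` of `R`, the set `C ∩ 𝔭` is a prime ideal of `C`. -/
def IsPrimePartialIdeal {R : Type*} [Ring R] (𝔭 : Set R) : Prop :=
  ∀ C : Subring R, (∀ a ∈ C, ∀ b ∈ C, a * b = b * a) →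
    ∃ I : Ideal C, I.IsPrime ∧ ∀ x : C, x ∈ I ↔ (x : R) ∈ 𝔭

/-- A projection in `M₃(ℂ)` is a matrix `P` with `P² = P` and `Pᴴ = P`. -/
def IsProjection (P : Matrix (Fin 3) (Fin 3) ℂ) : Prop :=
  P * P = P ∧ Pᴴ = P

namespace IsPrimePartialIdeal

variable {R S : Type*} [Ring R] [Ring S] {𝔭 : Set R}

/-- The preimage of a prime partial ideal under a ring homomorphism is a prime partial ideal. -/
theorem comap {𝔮 : Set S} (h : IsPrimePartialIdeal 𝔮) (φ : R →+* S) :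
    IsPrimePartialIdeal (φ ⁻¹' 𝔮) := by
  intro C hC
  obtain ⟨I, hI, hmem⟩ := h (C.map φ) (by
    rintro _ ⟨a, ha, rfl⟩ _ ⟨b, hb, rfl⟩
    rw [← map_mul, ← map_mul, hC a ha b hb])
  let ψ : C →+* C.map φ :=
    (φ.comp C.subtype).codRestrict (C.map φ) fun x => ⟨x, x.2, rfl⟩
  exact ⟨I.comap ψ, hI.comap ψ, fun x => hmem (ψ x)⟩

/-- Two commuting elements lie in a common subring on which `𝔭` is a prime ideal. -/
theorem exists_subring_of_commute (h : IsPrimePartialIdeal 𝔭) {a b : R} (hab : a * b = b * a) :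
    ∃ C : Subring R, a ∈ C ∧ b ∈ C ∧
      ∃ I : Ideal C, I.IsPrime ∧ ∀ x : C, x ∈ I ↔ (x : R) ∈ 𝔭 := by
  have hcomm : ∀ x ∈ Subring.closure {a, b}, ∀ y ∈ Subring.closure {a, b}, x * y = y * x := by
    have hgen : ∀ x ∈ ({a, b} : Set R), ∀ y ∈ ({a, b} : Set R), x * y = y * x := by
      rintro x (rfl | rfl) y (rfl | rfl) <;> simp [hab]
    have := Subring.isMulCommutative_closure hgen
    exact fun x hx y hy => congrArg Subtype.val
      (mul_comm' (⟨x, hx⟩ : Subring.closure {a, b}) ⟨y, hy⟩)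
  exact ⟨_, Subring.subset_closure (by simp), Subring.subset_closure (by simp), h _ hcomm⟩

/-- If an element is not in a prime partial ideal, then every element orthogonal to it is. -/
theorem mem_of_notMem (h : IsPrimePartialIdeal 𝔭) {a b : R} (ha' : a ∉ 𝔭)
    (hab : a * b = 0) (hba : b * a = 0) : b ∈ 𝔭 := by
  obtain ⟨C, ha, hb, I, hI, hmem⟩ := h.exists_subring_of_commute (hab.trans hba.symm)
  have hzero : (⟨a, ha⟩ * ⟨b, hb⟩ : C) ∈ I := by
    have : (⟨a, ha⟩ * ⟨b, hb⟩ : C) = 0 := Subtype.ext hab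
    rw [this]
    exact I.zero_mem
  exact (hmem _).1 ((hI.mem_or_mem hzero).resolve_left fun h' => ha' ((hmem _).1 h'))

/-- A prime partial ideal does not contain all the terms of a commuting decomposition of `1`. -/
theorem notMem_of_mem (h : IsPrimePartialIdeal 𝔭) {a b c : R} (ha' : a ∈ 𝔭) (hb' : b ∈ 𝔭)
    (hab : a * b = b * a) (hsum : a + b + c = 1) : c ∉ 𝔭 := by
  intro hc'
  obtain ⟨C, ha, hb, I, hI, hmem⟩ := h.exists_subring_of_commute hab
  have hc : c ∈ C := by
    rw [← sub_eq_of_eq_add' hsum.symm]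
    exact C.sub_mem C.one_mem (C.add_mem ha hb)
  refine hI.ne_top ((Ideal.eq_top_iff_one I).2 ?_)
  have : (1 : C) = ⟨a, ha⟩ + ⟨b, hb⟩ + ⟨c, hc⟩ := Subtype.ext hsum.symm
  rw [this]
  exact I.add_mem (I.add_mem ((hmem _).2 ha') ((hmem _).2 hb')) ((hmem _).2 hc')

end IsPrimePartialIdeal

/-- The matrix unit `e₀₀` belongs to every prime partial ideal of `M₃(ℤ)`. -/
theorem single_zero_mem {𝔭 : Set (Matrix (Fin 3) (Fin 3) ℤ)} (h : IsPrimePartialIdeal 𝔭) :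
    !![1, 0, 0; 0, 0, 0; 0, 0, 0] ∈ 𝔭 := by
  by_contra hE
  have h₁ : !![0, 0, 0; 0, 0, 0; 0, -1, 1] ∈ 𝔭 := h.mem_of_notMem hE (by decide) (by decide)
  have h₂ : !![0, 0, 0; 0, 0, 0; 0, 0, 1] ∈ 𝔭 := h.mem_of_notMem hE (by decide) (by decide)
  have h₃ : !![0, 0, 0; 0, 0, 1; 0, 0, 1] ∈ 𝔭 := h.mem_of_notMem hE (by decide) (by decide)
  have h₄ : !![0, 0, 0; 0, 1, -1; 0, 0, 0] ∈ 𝔭 := h.mem_of_notMem hE (by decide) (by decide)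
  have h₅ : !![0, 0, -1; 0, 0, 1; 0, 0, 1] ∈ 𝔭 := by
    by_contra h₅
    have h₆ : !![1, 1, 0; 0, 0, 0; 0, 0, 0] ∈ 𝔭 := h.mem_of_notMem h₅ (by decide) (by decide)
    have h₇ : !![0, -1, 1; 0, 1, -1; 0, 0, 0] ∈ 𝔭 := h.mem_of_notMem h₅ (by decide) (by decide)
    have h₈ : !![1, 1, -1; 0, 0, 0; 0, 0, 0] ∉ 𝔭 :=
      h.notMem_of_mem h₇ h₃ (by decide) (by decide)
    have h₉ : !![0, -1, 0; 0, 1, 0; 0, 0, 0] ∉ 𝔭 :=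
      h.notMem_of_mem h₂ h₆ (by decide) (by decide)
    exact h₉ (h.mem_of_notMem h₈ (by decide) (by decide))
  have h₁₀ : !![1, 0, 1; 0, 0, 0; 0, 0, 0] ∉ 𝔭 :=
    h.notMem_of_mem h₅ h₄ (by decide) (by decide)
  have h₁₁ : !![0, -1, -1; 0, 0, 0; 0, 1, 1] ∈ 𝔭 := h.mem_of_notMem h₁₀ (by decide) (by decide)
  have h₁₂ : !![1, 0, 0; -1, 0, 0; -1, 0, 0] ∉ 𝔭 := by
    intro h₁₂
    have h₁₃ : !![0, 0, 0; 1, 0, 1; 1, 0, 1] ∉ 𝔭 :=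
      h.notMem_of_mem h₄ h₁₂ (by decide) (by decide)
    have h₁₄ : !![0, 0, 0; 1, 1, 0; 1, 1, 0] ∉ 𝔭 :=
      h.notMem_of_mem h₁ h₁₂ (by decide) (by decide)
    have h₁₅ : !![0, 0, 0; 1, 1, -1; 0, 0, 0] ∈ 𝔭 := h.mem_of_notMem h₁₃ (by decide) (by decide)
    have h₁₆ : !![1, 0, 0; -1, 0, 0; 0, 0, 0] ∈ 𝔭 := h.mem_of_notMem h₁₄ (by decide) (by decide)
    exact h.notMem_of_mem h₃ h₁₅ (by decide) (by decide) h₁₆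
  have h₁₇ : !![0, 0, 0; 1, 1, 0; 0, 0, 0] ∈ 𝔭 := h.mem_of_notMem h₁₂ (by decide) (by decide)
  have h₁₈ : !![0, 0, 0; -1, 0, -1; 1, 0, 1] ∈ 𝔭 := h.mem_of_notMem h₁₂ (by decide) (by decide)
  have h₁₉ : !![1, 0, 1; -1, 0, -1; 0, 0, 0] ∉ 𝔭 :=
    h.notMem_of_mem h₅ h₁₇ (by decide) (by decide)
  have h₂₀ : !![1, 1, 1; 1, 1, 1; -1, -1, -1] ∉ 𝔭 :=
    h.notMem_of_mem h₁₁ h₁₈ (by decide) (by decide)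
  exact h₂₀ (h.mem_of_notMem h₁₉ (by decide) (by decide))

/-- The ring `M₃(ℤ)` has no prime partial ideals. -/
theorem not_isPrimePartialIdeal_int (𝔭 : Set (Matrix (Fin 3) (Fin 3) ℤ)) :
    ¬ IsPrimePartialIdeal 𝔭 := by
  intro h
  have hreindex (σ : Fin 3 ≃ Fin 3) :=
    single_zero_mem (h.comap (reindexRingEquiv ℤ σ : _ →+* Matrix (Fin 3) (Fin 3) ℤ))
  have key (σ : Fin 3 ≃ Fin 3) (A : Matrix (Fin 3) (Fin 3) ℤ)
      (hA : reindex σ σ !![1, 0, 0; 0, 0, 0; 0, 0, 0] = A) : A ∈ 𝔭 := hA ▸ hreindex σ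
  have h₀ := key (Equiv.refl _) !![1, 0, 0; 0, 0, 0; 0, 0, 0] (by decide)
  have h₁ := key (Equiv.swap 0 1) !![0, 0, 0; 0, 1, 0; 0, 0, 0] (by decide)
  have h₂ := key (Equiv.swap 0 2) !![0, 0, 0; 0, 0, 0; 0, 0, 1] (by decide)
  exact h.notMem_of_mem h₀ h₁ (by decide) (by decide) h₂

/-- If `𝔭` is a prime partial ideal of `M₃(ℂ)` and `c` is the indicator coloring sending
members of `𝔭` to `0` and non-members to `1`, then for all commuting projections `P, Q`
one has `c (P + Q) = c P + c Q` and `c (P * Q) = c P * c Q`. -/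
theorem coloring_of_prime_partial_ideal
    (𝔭 : Set (Matrix (Fin 3) (Fin 3) ℂ)) (h𝔭 : IsPrimePartialIdeal 𝔭)
    (c : Matrix (Fin 3) (Fin 3) ℂ → ℤ)
    (hc0 : ∀ X, X ∈ 𝔭 → c X = 0) (hc1 : ∀ X, X ∉ 𝔭 → c X = 1) :
    ∀ P Q : Matrix (Fin 3) (Fin 3) ℂ, IsProjection P → IsProjection Q →
      P * Q = Q * P →
        c (P + Q) = c P + c Q ∧ c (P * Q) = c P * c Q := by
  exact (not_isPrimePartialIdeal_int _ (h𝔭.comap (Int.castRingHom ℂ).mapMatrix)).elim
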